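/- If δ < −δ₁, then u_δ′(x) < 0 for every x ∈ ℝ, so u_δ is decreasing on ℝ; hence u_δ < 0 on (0, +∞) and u_δ > 0 on (−∞, 0). -/

import Mathlib

noncomputable section

open Real Filter Topology intervalIntegral

/-- The normalized nonlinearity `f_{a,A}`: `f/a` where `f > 0`, `f/A` where `f < 0`,
and `0` where `f = 0`. -/
def faA (a A : ℝ) (f : ℝ → ℝ) (t : ℝ) : ℝ :=
  if 0 < f t then f t / a else if f t < 0 then f t / A else 0

/-- `u` is a weak solution of `-|u'|^α u'' = f_{a,A}(u)` on all of `ℝ`: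
`u` is C¹ and `x ↦ |u'|^α u'` is differentiable with (continuous) derivative
`-(1+α)·f_{a,A}(u(x))`. -/
def IsWeakSolR (α a A : ℝ) (f : ℝ → ℝ) (u : ℝ → ℝ) : Prop :=
  Differentiable ℝ u ∧ Continuous (deriv u) ∧
  ∀ x : ℝ, HasDerivAt (fun y => |deriv u y| ^ α * deriv u y)
    (-(1 + α) * faA a A f (u x)) x

/-- The nonlinearity `faA` is continuous as soon as `f` is. -/
theorem continuous_faA {f : ℝ → ℝ} (hf : Continuous f) (a A : ℝ) :
    Continuous (faA a A f) := by
  have h : faA a A f = fun t => max (f t) 0 / a + min (f t) 0 / A := by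
    funext t
    unfold faA
    split_ifs with h1 h2
    · simp [max_eq_left h1.le, min_eq_right h1.le]
    · simp [max_eq_right h2.le, min_eq_left h2.le]
    · simp [le_antisymm (not_lt.mp h1) (not_lt.mp h2)]
  rw [h]
  fun_prop

/-- The odd power `|y|^α y` determines `|y|^(2+α)`. -/
theorem abs_rpow_mul_self_rpow {α : ℝ} (hα : -1 < α) (y : ℝ) :
    |(|y| ^ α * y)| ^ ((2 + α) / (1 + α)) = |y| ^ (2 + α) := by
  have h1 : (1 + α) ≠ 0 := by linarith
  rcases eq_or_ne y 0 with rfl | hy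
  · have h2 : (2 + α) ≠ 0 := by linarith
    simp [zero_rpow h2, zero_rpow (div_ne_zero h2 h1)]
  · have hy' : 0 < |y| := abs_pos.mpr hy
    rw [abs_mul, abs_of_nonneg (rpow_nonneg hy'.le α), ← rpow_add_one hy'.ne',
      ← rpow_mul hy'.le]
    congr 1
    field_simp
    ring

/-- Inversion of the odd power `y ↦ |y|^α y`. -/
theorem abs_rpow_mul_self_inv {α : ℝ} (hα : -1 < α) (y : ℝ) :
    |(|y| ^ α * y)| ^ ((2 + α) / (1 + α) - 2) * (|y| ^ α * y) = y := by
  have h1 : (1 + α) ≠ 0 := by linarith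
  rcases eq_or_ne y 0 with rfl | hy
  · simp
  · have hy' : 0 < |y| := abs_pos.mpr hy
    rw [abs_mul, abs_of_nonneg (rpow_nonneg hy'.le α), ← rpow_add_one hy'.ne',
      ← rpow_mul hy'.le, ← mul_assoc, ← rpow_add hy']
    have h : (α + 1) * ((2 + α) / (1 + α) - 2) + α = 0 := by
      field_simp
      ring
    rw [h, rpow_zero, one_mul]

/-- Conservation of energy for weak solutions. -/
theorem IsWeakSolR.energy_eq {α a A : ℝ} {f u : ℝ → ℝ} (hα : -1 < α)
    (hf : Continuous f) (hu : IsWeakSolR α a A f u) (x y : ℝ) :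
    |deriv u x| ^ (2 + α) + (2 + α) * ∫ s in (0:ℝ)..u x, faA a A f s =
      |deriv u y| ^ (2 + α) + (2 + α) * ∫ s in (0:ℝ)..u y, faA a A f s := by
  obtain ⟨hud, -, hv⟩ := hu
  have hc := continuous_faA hf a A
  have h1 : (1 + α) ≠ 0 := by linarith
  have hp : 1 < (2 + α) / (1 + α) := by
    rw [lt_div_iff₀ (by linarith)]
    linarith
  have key : ∀ z, HasDerivAt (fun w => |deriv u w| ^ (2 + α) +
      (2 + α) * ∫ s in (0:ℝ)..u w, faA a A f s) 0 z := by
    intro z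
    have hkin := (hasDerivAt_abs_rpow (|deriv u z| ^ α * deriv u z) hp).comp z (hv z)
    have hpot : HasDerivAt (fun w => ∫ s in (0:ℝ)..u w, faA a A f s)
        (faA a A f (u z) * deriv u z) z :=
      (hc.integral_hasStrictDerivAt 0 (u z)).hasDerivAt.comp z (hud z).hasDerivAt
    rw [mul_assoc ((2 + α) / (1 + α)), abs_rpow_mul_self_inv hα] at hkin
    have hsum := hkin.add (hpot.const_mul (2 + α))
    have h0 : (2 + α) / (1 + α) * (deriv u z * (-(1 + α) * faA a A f (u z))) +
        (2 + α) * (faA a A f (u z) * deriv u z) = 0 := by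
      field_simp
      ring
    rw [mul_assoc, h0] at hsum
    refine hsum.congr_of_eventuallyEq (Eventually.of_forall fun w => ?_)
    simp [← abs_rpow_mul_self_rpow hα, -abs_mul]
  exact is_const_of_deriv_eq_zero (fun z => (key z).differentiableAt)
    (fun z => (key z).deriv) x y

/-- **Proposition 5.2, case 4.** If `δ < -δ₁`, then `u_δ' < 0` everywhere, so
`u_δ` is decreasing; hence `u_δ < 0` on `(0,+∞)` and `u_δ > 0` on `(-∞,0)`. -/
theorem cauchy_case_negative
    (α a A : ℝ) (hα : -1 < α) (hα0 : α ≤ 0) (ha : 0 < a) (haA : a ≤ A)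
    (f : ℝ → ℝ) (hf : ContDiff ℝ 1 f)
    (hfm1 : f (-1) = 0) (hf0 : f 0 = 0) (hf1 : f 1 = 0)
    (hfpos : ∀ t ∈ Set.Ioo (0:ℝ) 1, 0 < f t)
    (hfneg : ∀ t ∈ Set.Ioo (-1:ℝ) 0, f t < 0)
    (hfge : ∀ t : ℝ, t ≤ -1 → 0 ≤ f t)
    (hfle : ∀ t : ℝ, 1 ≤ t → f t ≤ 0)
    (hfbd : ∃ K : ℝ, ∀ t, |f t| ≤ K)
    (hfLip : ∃ K : NNReal, LipschitzWith K f)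
    (hfd1 : deriv f 1 < 0) (hfdm1 : deriv f (-1) < 0)
    (hbal : (∫ s in (-1:ℝ)..1, faA a A f s) = 0)
    (hint : ∀ t : ℝ, t ≠ -1 → t ≠ 1 → 0 < ∫ s in t..1, faA a A f s)
    (δ δ₁ : ℝ)
    (hδ₁ : δ₁ = ((2 + α) * ∫ s in (0:ℝ)..1, f s / a) ^ ((1:ℝ) / (2 + α)))
    (u : ℝ → ℝ) (hu : IsWeakSolR α a A f u)
    (hu0 : u 0 = 0) (hud0 : deriv u 0 = δ)
    (hδ : δ < -δ₁) :
    (∀ x : ℝ, deriv u x < 0) ∧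
    StrictAnti u ∧
    (∀ x : ℝ, 0 < x → u x < 0) ∧
    (∀ x : ℝ, x < 0 → 0 < u x) := by
  have hcf := hf.continuous
  have hc := continuous_faA hcf a A
  have h2 : 0 < 2 + α := by linarith
  have hI : ∫ s in (0:ℝ)..1, f s / a = ∫ s in (0:ℝ)..1, faA a A f s := by
    refine integral_congr fun t ht => ?_
    rw [Set.uIcc_of_le zero_le_one] at ht
    rcases eq_or_lt_of_le ht.1 with rfl | h0
    · simp [faA, hf0]
    rcases eq_or_lt_of_le ht.2 with rfl | h1
    · simp [faA, hf1]
    · simp [faA, hfpos t ⟨h0, h1⟩]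
  have hI0 : 0 < ∫ s in (0:ℝ)..1, faA a A f s := hint 0 (by norm_num) (by norm_num)
  have hmax : ∀ t, ∫ s in (0:ℝ)..t, faA a A f s ≤ ∫ s in (0:ℝ)..1, faA a A f s := by
    intro t
    have hsplit := integral_add_adjacent_intervals (hc.intervalIntegrable 0 t)
      (hc.intervalIntegrable (μ := MeasureTheory.volume) t 1)
    have hnn : 0 ≤ ∫ s in t..1, faA a A f s := by
      by_cases hm : t = -1
      · rw [hm, hbal]
      by_cases h1 : t = 1
      · simp [h1]
      · exact (hint t hm h1).le
    linarith
  have hδ₁0 : 0 ≤ δ₁ := by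
    rw [hδ₁, hI]
    positivity
  have hδ₁p : δ₁ ^ (2 + α) = (2 + α) * ∫ s in (0:ℝ)..1, faA a A f s := by
    rw [hδ₁, hI, ← rpow_mul (by positivity), one_div_mul_cancel h2.ne', rpow_one]
  have hδp : δ₁ ^ (2 + α) < |δ| ^ (2 + α) :=
    rpow_lt_rpow hδ₁0 (by rw [abs_of_neg] <;> linarith) h2
  have hne : ∀ x, deriv u x ≠ 0 := by
    intro x hx
    have hE := hu.energy_eq hα hcf x 0
    rw [hx, hu0, hud0, abs_zero, zero_rpow h2.ne', integral_same] at hE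
    have := mul_le_mul_of_nonneg_left (hmax (u x)) h2.le
    linarith
  have hneg : ∀ x, deriv u x < 0 := by
    intro x
    by_contra! hx
    obtain ⟨z, hz⟩ := mem_range_of_exists_le_of_exists_ge hu.2.1
      ⟨0, by rw [hud0]; linarith⟩ ⟨x, hx⟩
    exact hne z hz
  have hanti : StrictAnti u := strictAnti_of_deriv_neg hneg
  exact ⟨hneg, hanti, fun x hx => hu0 ▸ hanti hx, fun x hx => hu0 ▸ hanti hx⟩
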